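/- Let K be a field of characteristic zero containing a primitive 5th root of unity zeta; set phi = 1 + zeta + zeta^4 and kappa = zeta^4 - zeta. Then in K[a,b] the following identities hold, where F(u,v) denotes the result of substituting a = u, b = v into the binary form F: D(zeta^2*a, zeta^3*b) = D(a,b), c4(zeta^2*a, zeta^3*b) = c4(a,b), c6(zeta^2*a, zeta^3*b) = c6(a,b), and D(phi*a + b, a - phi*b) = kappa^12 * D(a,b), c4(phi*a + b, a - phi*b) = kappa^20 * c4(a,b), c6(phi*a + b, a - phi*b) = kappa^30 * c6(a,b). -/

import Mathlib

open MvPolynomial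

/-- The binary form `D = a*b*(a^10 - 11 a^5 b^5 - b^10)` in `K[a,b]`. -/
noncomputable def Dpoly (K : Type*) [CommRing K] : MvPolynomial (Fin 2) K :=
  X 0 * X 1 * (X 0 ^ 10 - 11 * X 0 ^ 5 * X 1 ^ 5 - X 1 ^ 10)

/-- The binary form `c4` in `K[a,b]`. -/
noncomputable def c4poly (K : Type*) [CommRing K] : MvPolynomial (Fin 2) K :=
  X 0 ^ 20 + 228 * X 0 ^ 15 * X 1 ^ 5 + 494 * X 0 ^ 10 * X 1 ^ 10
    - 228 * X 0 ^ 5 * X 1 ^ 15 + X 1 ^ 20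

/-- The binary form `c6` in `K[a,b]`. -/
noncomputable def c6poly (K : Type*) [CommRing K] : MvPolynomial (Fin 2) K :=
  -(X 0 ^ 30) + 522 * X 0 ^ 25 * X 1 ^ 5 + 10005 * X 0 ^ 20 * X 1 ^ 10
    + 10005 * X 0 ^ 10 * X 1 ^ 20 - 522 * X 0 ^ 5 * X 1 ^ 25 - X 1 ^ 30

set_option maxRecDepth 100000

set_option maxHeartbeats 4000000 in
lemma D_aux {R : Type*} [CommRing R] (p a b : R) (h : p ^ 2 = p + 1) :
    (p * a + b) * (a - p * b) * ((p * a + b) ^ 10 - 11 * (p * a + b) ^ 5 * (a - p * b) ^ 5 - (a - p * b) ^ 10)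
    = (p + 2) ^ 6 * (a * b * (a ^ 10 - 11 * a ^ 5 * b ^ 5 - b ^ 10)) := by
  have q3 : p ^ 3 = 2 * p + 1 := by
    linear_combination (p + 1) * h
  have q4 : p ^ 4 = 3 * p + 2 := by
    linear_combination p * q3 + 2 * h
  have q5 : p ^ 5 = 5 * p + 3 := by
    linear_combination p * q4 + 3 * h
  have q6 : p ^ 6 = 8 * p + 5 := by
    linear_combination p * q5 + 5 * h
  have q7 : p ^ 7 = 13 * p + 8 := by
    linear_combination p * q6 + 8 * h
  have q8 : p ^ 8 = 21 * p + 13 := by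
    linear_combination p * q7 + 13 * h
  have q9 : p ^ 9 = 34 * p + 21 := by
    linear_combination p * q8 + 21 * h
  have q10 : p ^ 10 = 55 * p + 34 := by
    linear_combination p * q9 + 34 * h
  have q11 : p ^ 11 = 89 * p + 55 := by
    linear_combination p * q10 + 55 * h
  have q12 : p ^ 12 = 144 * p + 89 := by
    linear_combination p * q11 + 89 * h
  ring_nf
  simp only [h, q3, q4, q5, q6, q7, q8, q9, q10, q11, q12]
  ring

set_option maxHeartbeats 4000000 in
lemma c4_aux {R : Type*} [CommRing R] (p a b : R) (h : p ^ 2 = p + 1) :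
    (p * a + b) ^ 20 + 228 * (p * a + b) ^ 15 * (a - p * b) ^ 5 + 494 * (p * a + b) ^ 10 * (a - p * b) ^ 10
      - 228 * (p * a + b) ^ 5 * (a - p * b) ^ 15 + (a - p * b) ^ 20
    = (p + 2) ^ 10 * (a ^ 20 + 228 * a ^ 15 * b ^ 5 + 494 * a ^ 10 * b ^ 10
      - 228 * a ^ 5 * b ^ 15 + b ^ 20) := by
  have q3 : p ^ 3 = 2 * p + 1 := by
    linear_combination (p + 1) * h
  have q4 : p ^ 4 = 3 * p + 2 := by
    linear_combination p * q3 + 2 * h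
  have q5 : p ^ 5 = 5 * p + 3 := by
    linear_combination p * q4 + 3 * h
  have q6 : p ^ 6 = 8 * p + 5 := by
    linear_combination p * q5 + 5 * h
  have q7 : p ^ 7 = 13 * p + 8 := by
    linear_combination p * q6 + 8 * h
  have q8 : p ^ 8 = 21 * p + 13 := by
    linear_combination p * q7 + 13 * h
  have q9 : p ^ 9 = 34 * p + 21 := by
    linear_combination p * q8 + 21 * h
  have q10 : p ^ 10 = 55 * p + 34 := by
    linear_combination p * q9 + 34 * h
  have q11 : p ^ 11 = 89 * p + 55 := by
    linear_combination p * q10 + 55 * h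
  have q12 : p ^ 12 = 144 * p + 89 := by
    linear_combination p * q11 + 89 * h
  have q13 : p ^ 13 = 233 * p + 144 := by
    linear_combination p * q12 + 144 * h
  have q14 : p ^ 14 = 377 * p + 233 := by
    linear_combination p * q13 + 233 * h
  have q15 : p ^ 15 = 610 * p + 377 := by
    linear_combination p * q14 + 377 * h
  have q16 : p ^ 16 = 987 * p + 610 := by
    linear_combination p * q15 + 610 * h
  have q17 : p ^ 17 = 1597 * p + 987 := by
    linear_combination p * q16 + 987 * h
  have q18 : p ^ 18 = 2584 * p + 1597 := by
    linear_combination p * q17 + 1597 * h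
  have q19 : p ^ 19 = 4181 * p + 2584 := by
    linear_combination p * q18 + 2584 * h
  have q20 : p ^ 20 = 6765 * p + 4181 := by
    linear_combination p * q19 + 4181 * h
  ring_nf
  simp only [h, q3, q4, q5, q6, q7, q8, q9, q10, q11, q12, q13, q14, q15, q16, q17, q18, q19, q20]
  ring

set_option maxHeartbeats 4000000 in
lemma c6_aux {R : Type*} [CommRing R] (p a b : R) (h : p ^ 2 = p + 1) :
    -((p * a + b) ^ 30) + 522 * (p * a + b) ^ 25 * (a - p * b) ^ 5 + 10005 * (p * a + b) ^ 20 * (a - p * b) ^ 10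
      + 10005 * (p * a + b) ^ 10 * (a - p * b) ^ 20 - 522 * (p * a + b) ^ 5 * (a - p * b) ^ 25 - (a - p * b) ^ 30
    = (-(p + 2) ^ 15) * (-(a ^ 30) + 522 * a ^ 25 * b ^ 5 + 10005 * a ^ 20 * b ^ 10
      + 10005 * a ^ 10 * b ^ 20 - 522 * a ^ 5 * b ^ 25 - b ^ 30) := by
  have q3 : p ^ 3 = 2 * p + 1 := by
    linear_combination (p + 1) * h
  have q4 : p ^ 4 = 3 * p + 2 := by
    linear_combination p * q3 + 2 * h
  have q5 : p ^ 5 = 5 * p + 3 := by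
    linear_combination p * q4 + 3 * h
  have q6 : p ^ 6 = 8 * p + 5 := by
    linear_combination p * q5 + 5 * h
  have q7 : p ^ 7 = 13 * p + 8 := by
    linear_combination p * q6 + 8 * h
  have q8 : p ^ 8 = 21 * p + 13 := by
    linear_combination p * q7 + 13 * h
  have q9 : p ^ 9 = 34 * p + 21 := by
    linear_combination p * q8 + 21 * h
  have q10 : p ^ 10 = 55 * p + 34 := by
    linear_combination p * q9 + 34 * h
  have q11 : p ^ 11 = 89 * p + 55 := by
    linear_combination p * q10 + 55 * h
  have q12 : p ^ 12 = 144 * p + 89 := by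
    linear_combination p * q11 + 89 * h
  have q13 : p ^ 13 = 233 * p + 144 := by
    linear_combination p * q12 + 144 * h
  have q14 : p ^ 14 = 377 * p + 233 := by
    linear_combination p * q13 + 233 * h
  have q15 : p ^ 15 = 610 * p + 377 := by
    linear_combination p * q14 + 377 * h
  have q16 : p ^ 16 = 987 * p + 610 := by
    linear_combination p * q15 + 610 * h
  have q17 : p ^ 17 = 1597 * p + 987 := by
    linear_combination p * q16 + 987 * h
  have q18 : p ^ 18 = 2584 * p + 1597 := by
    linear_combination p * q17 + 1597 * h
  have q19 : p ^ 19 = 4181 * p + 2584 := by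
    linear_combination p * q18 + 2584 * h
  have q20 : p ^ 20 = 6765 * p + 4181 := by
    linear_combination p * q19 + 4181 * h
  have q21 : p ^ 21 = 10946 * p + 6765 := by
    linear_combination p * q20 + 6765 * h
  have q22 : p ^ 22 = 17711 * p + 10946 := by
    linear_combination p * q21 + 10946 * h
  have q23 : p ^ 23 = 28657 * p + 17711 := by
    linear_combination p * q22 + 17711 * h
  have q24 : p ^ 24 = 46368 * p + 28657 := by
    linear_combination p * q23 + 28657 * h
  have q25 : p ^ 25 = 75025 * p + 46368 := by
    linear_combination p * q24 + 46368 * h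
  have q26 : p ^ 26 = 121393 * p + 75025 := by
    linear_combination p * q25 + 75025 * h
  have q27 : p ^ 27 = 196418 * p + 121393 := by
    linear_combination p * q26 + 121393 * h
  have q28 : p ^ 28 = 317811 * p + 196418 := by
    linear_combination p * q27 + 196418 * h
  have q29 : p ^ 29 = 514229 * p + 317811 := by
    linear_combination p * q28 + 317811 * h
  have q30 : p ^ 30 = 832040 * p + 514229 := by
    linear_combination p * q29 + 514229 * h
  ring_nf
  simp only [h, q3, q4, q5, q6, q7, q8, q9, q10, q11, q12, q13, q14, q15, q16, q17, q18, q19, q20, q21, q22, q23, q24, q25, q26, q27, q28, q29, q30]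
  ring

/-- `D`, `c4`, `c6` are invariant under `(a,b) ↦ (ζ²a, ζ³b)` and transform with the
indicated powers of `κ = ζ⁴ - ζ` under `(a,b) ↦ (φa + b, a - φb)`,
where `φ = 1 + ζ + ζ⁴` for `ζ` a primitive 5th root of unity. -/
theorem discrete_invariants_transformation
    (K : Type*) [Field K] [CharZero K] (ζ φ κ : K)
    (hζ : IsPrimitiveRoot ζ 5) (hφ : φ = 1 + ζ + ζ ^ 4) (hκ : κ = ζ ^ 4 - ζ) :
    aeval ![C (ζ ^ 2) * X 0, C (ζ ^ 3) * X 1] (Dpoly K) = Dpoly K ∧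
    aeval ![C (ζ ^ 2) * X 0, C (ζ ^ 3) * X 1] (c4poly K) = c4poly K ∧
    aeval ![C (ζ ^ 2) * X 0, C (ζ ^ 3) * X 1] (c6poly K) = c6poly K ∧
    aeval ![C φ * X 0 + X 1, X 0 - C φ * X 1] (Dpoly K) = C (κ ^ 12) * Dpoly K ∧
    aeval ![C φ * X 0 + X 1, X 0 - C φ * X 1] (c4poly K) = C (κ ^ 20) * c4poly K ∧
    aeval ![C φ * X 0 + X 1, X 0 - C φ * X 1] (c6poly K) = C (κ ^ 30) * c6poly K := by
  have h5 : ζ ^ 5 = 1 := hζ.pow_eq_one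
  have hsum : ζ ^ 4 + ζ ^ 3 + ζ ^ 2 + ζ + 1 = 0 := by
    have h1 : ζ - 1 ≠ 0 := sub_ne_zero.mpr (hζ.ne_one (by norm_num))
    apply mul_left_cancel₀ h1
    linear_combination h5
  have hp : φ ^ 2 = φ + 1 := by
    rw [hφ]
    linear_combination (ζ ^ 3 + 2) * h5 + hsum
  have hk : κ ^ 2 = -(φ + 2) := by
    rw [hφ, hκ]
    linear_combination (ζ ^ 3 - 2) * h5 + hsum
  have hk12 : κ ^ 12 = (φ + 2) ^ 6 := by
    rw [show κ ^ 12 = (κ ^ 2) ^ 6 by ring, hk]; ring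
  have hk20 : κ ^ 20 = (φ + 2) ^ 10 := by
    rw [show κ ^ 20 = (κ ^ 2) ^ 10 by ring, hk]; ring
  have hk30 : κ ^ 30 = -(φ + 2) ^ 15 := by
    rw [show κ ^ 30 = (κ ^ 2) ^ 15 by ring, hk]; ring
  have hP : (C φ : MvPolynomial (Fin 2) K) ^ 2 = C φ + 1 := by
    rw [← C_pow, hp, C_add, C_1]
  have hC2 : (C (2 : K) : MvPolynomial (Fin 2) K) = 2 := map_ofNat C 2
  have hZ : (C ζ : MvPolynomial (Fin 2) K) ^ 5 = 1 := by
    rw [← C_pow, h5, C_1]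
  have e2 : (C (ζ ^ 2) * X 0 : MvPolynomial (Fin 2) K) ^ 5 = X 0 ^ 5 := by
    rw [C_pow]
    linear_combination (C ζ ^ 5 + 1) * X 0 ^ 5 * hZ
  have e3 : (C (ζ ^ 3) * X 1 : MvPolynomial (Fin 2) K) ^ 5 = X 1 ^ 5 := by
    rw [C_pow]
    linear_combination (C ζ ^ 10 + C ζ ^ 5 + 1) * X 1 ^ 5 * hZ
  have e23 : (C (ζ ^ 2) * X 0 * (C (ζ ^ 3) * X 1) : MvPolynomial (Fin 2) K) = X 0 * X 1 := by
    rw [C_pow, C_pow]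
    linear_combination X 0 * X 1 * hZ
  have red : ∀ (x : MvPolynomial (Fin 2) K), x ^ 10 = (x ^ 5) ^ 2 ∧ x ^ 15 = (x ^ 5) ^ 3 ∧
      x ^ 20 = (x ^ 5) ^ 4 ∧ x ^ 25 = (x ^ 5) ^ 5 ∧ x ^ 30 = (x ^ 5) ^ 6 := by
    intro x
    refine ⟨?_, ?_, ?_, ?_, ?_⟩ <;> ring
  obtain ⟨a10, a15, a20, a25, a30⟩ := red (C (ζ ^ 2) * X 0)
  obtain ⟨b10, b15, b20, b25, b30⟩ := red (C (ζ ^ 3) * X 1)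
  refine ⟨?_, ?_, ?_, ?_, ?_, ?_⟩
  · simp only [Dpoly, map_add, map_sub, map_mul, map_pow, map_ofNat, aeval_X,
      Matrix.cons_val_zero, Matrix.cons_val_one]
    simp only [← C_pow]
    rw [a10, b10, e2, e3, e23]
    ring
  · simp only [c4poly, map_add, map_sub, map_mul, map_pow, map_ofNat, aeval_X,
      Matrix.cons_val_zero, Matrix.cons_val_one]
    simp only [← C_pow]
    rw [a10, b10, a15, b15, a20, b20, e2, e3]
    ring
  · simp only [c6poly, map_add, map_sub, map_mul, map_pow, map_neg, map_ofNat, aeval_X,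
      Matrix.cons_val_zero, Matrix.cons_val_one]
    simp only [← C_pow]
    rw [a10, b10, a20, b20, a25, b25, a30, b30, e2, e3]
    ring
  · rw [hk12, C_pow, C_add, hC2]
    simp only [Dpoly, map_add, map_sub, map_mul, map_pow, map_ofNat, aeval_X,
      Matrix.cons_val_zero, Matrix.cons_val_one]
    exact D_aux (C φ) (X 0) (X 1) hP
  · rw [hk20, C_pow, C_add, hC2]
    simp only [c4poly, map_add, map_sub, map_mul, map_pow, map_ofNat, aeval_X,
      Matrix.cons_val_zero, Matrix.cons_val_one]
    exact c4_aux (C φ) (X 0) (X 1) hP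
  · rw [hk30, C_neg, C_pow, C_add, hC2]
    simp only [c6poly, map_add, map_sub, map_mul, map_pow, map_neg, map_ofNat, aeval_X,
      Matrix.cons_val_zero, Matrix.cons_val_one]
    exact c6_aux (C φ) (X 0) (X 1) hP
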